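/- There exists a constant c ≥ 1 such that for all integers 0 ≤ n ≤ m there is a map 𝔈_{n,m} : (V_n → ℝ) → (V_m → ℝ) with the following properties for every f : V_n → ℝ: (a) (𝔈_{n,m}f)|_{V_n} = f; (b) for every w ∈ W_n, min_{p∈V₀} f(Ψ_w(p)) = min_{v∈V_{m−n}} (𝔈_{n,m}f)(Ψ_w(v)) and max_{p∈V₀} f(Ψ_w(p)) = max_{v∈V_{m−n}} (𝔈_{n,m}f)(Ψ_w(v)); (c) 𝓡̄_{m−n}·D_m(𝔈_{n,m}f) ≤ c·D_n(f). (Extension estimate; part (2) of Proposition 3.4 of the paper in the planar case.) -/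

import Mathlib

open Finset
open scoped Classical

namespace Carpet

/-- The contraction map `Ψ_{(a,b)}(x,y) = ((x+a)/L, (y+b)/L)`. -/
noncomputable def Psi (L : ℕ) (p : ℕ × ℕ) (x : ℝ × ℝ) : ℝ × ℝ :=
  ((x.1 + p.1) / L, (x.2 + p.2) / L)

/-- Words of length `n` over the alphabet `A`. -/
abbrev Word (A : Finset (ℕ × ℕ)) (n : ℕ) := Fin n → {p : ℕ × ℕ // p ∈ A}

/-- `Ψ_w = Ψ_{w₁} ∘ ⋯ ∘ Ψ_{w_n}`. -/
noncomputable def PsiW (L : ℕ) {A : Finset (ℕ × ℕ)} {n : ℕ} (w : Word A n) : ℝ × ℝ → ℝ × ℝ :=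
  (List.ofFn fun i => Psi L (w i).1).foldr (· ∘ ·) id

/-- The four corners of the unit square. -/
noncomputable def V0 : Finset (ℝ × ℝ) :=
  {((0 : ℝ), (0 : ℝ)), ((1 : ℝ), (0 : ℝ)), ((1 : ℝ), (1 : ℝ)), ((0 : ℝ), (1 : ℝ))}

/-- The level-`n` vertex set `V_n = ⋃_{w ∈ W_n} Ψ_w(V₀)`. -/
noncomputable def VN (L : ℕ) (A : Finset (ℕ × ℕ)) (n : ℕ) : Finset (ℝ × ℝ) :=
  (Finset.univ : Finset (Word A n)).biUnion fun w => V0.image (PsiW L w)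

/-- Euclidean distance in the plane. -/
noncomputable def eudist (x y : ℝ × ℝ) : ℝ :=
  Real.sqrt ((x.1 - y.1) ^ 2 + (x.2 - y.2) ^ 2)

/-- `n`-adjacency: `x = Ψ_w(p)`, `y = Ψ_w(q)` with `p, q ∈ V₀`, `|p - q| = 1`. -/
def Adj (L : ℕ) (A : Finset (ℕ × ℕ)) (n : ℕ) (x y : ℝ × ℝ) : Prop :=
  ∃ w : Word A n, ∃ p ∈ V0, ∃ q ∈ V0,
    eudist p q = 1 ∧ x = PsiW L w p ∧ y = PsiW L w q

/-- The natural graph energy `D_n(f) = Σ_{x ∼ y} (f x - f y)²`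
(summing over ordered pairs and halving). -/
noncomputable def Dform (L : ℕ) (A : Finset (ℕ × ℕ)) (n : ℕ) (f : ℝ × ℝ → ℝ) : ℝ :=
  (1 / 2) * ∑ x ∈ VN L A n, ∑ y ∈ VN L A n,
    (if Adj L A n x y then (f x - f y) ^ 2 else 0)

/-- The effective resistance between `S` and `T` in the level-`n` graph. -/
noncomputable def EffRes (L : ℕ) (A : Finset (ℕ × ℕ)) (n : ℕ) (S T : Set (ℝ × ℝ)) : ℝ :=
  (sInf {e : ℝ | ∃ f : ℝ × ℝ → ℝ,
      (∀ x ∈ S, f x = 1) ∧ (∀ x ∈ T, f x = 0) ∧ e = Dform L A n f})⁻¹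

/-- `𝓡_n`, the resistance between the corners `(0,0)` and `(1,0)`. -/
noncomputable def RR (L : ℕ) (A : Finset (ℕ × ℕ)) (n : ℕ) : ℝ :=
  EffRes L A n {((0 : ℝ), (0 : ℝ))} {((1 : ℝ), (0 : ℝ))}

/-- `𝓡̄_n`, the resistance between the left and right sides of the unit square. -/
noncomputable def RRbar (L : ℕ) (A : Finset (ℕ × ℕ)) (n : ℕ) : ℝ :=
  EffRes L A n
    ((VN L A n : Set (ℝ × ℝ)) ∩ ({(0 : ℝ)} ×ˢ Set.Icc (0 : ℝ) 1))
    ((VN L A n : Set (ℝ × ℝ)) ∩ ({(1 : ℝ)} ×ˢ Set.Icc (0 : ℝ) 1))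

/-- The standing assumptions on `(L, A)` defining a generalized Sierpiński carpet. -/
structure GoodCarpet (L : ℕ) (A : Finset (ℕ × ℕ)) : Prop where
  three_le : 3 ≤ L
  mem_lt : ∀ p ∈ A, p.1 < L ∧ p.2 < L
  symm_swap : ∀ a b : ℕ, (a, b) ∈ A → (b, a) ∈ A
  symm_reflect : ∀ a b : ℕ, (a, b) ∈ A → (L - 1 - a, b) ∈ A
  connected : IsConnected
    (⋃ p ∈ A, Set.Icc (((p.1 : ℝ) / L, (p.2 : ℝ) / L) : ℝ × ℝ)
      ((((p.1 : ℝ) + 1) / L, ((p.2 : ℝ) + 1) / L) : ℝ × ℝ))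
  flat_border : ∀ a b : ℕ, a < L → b < L →
    (a = 0 ∨ a = L - 1 ∨ b = 0 ∨ b = L - 1) → (a, b) ∈ A
  proper : ∃ a b : ℕ, a < L ∧ b < L ∧ (a, b) ∉ A

/-- The generalized Sierpiński carpet `F`. -/
def carpetF (L : ℕ) (A : Finset (ℕ × ℕ)) : Set (ℝ × ℝ) :=
  ⋂ n : ℕ, ⋃ w : Word A n, PsiW L w '' Set.Icc (((0 : ℝ), (0 : ℝ)) : ℝ × ℝ) ((1 : ℝ), (1 : ℝ))


/-! ### Helper lemmas -/

lemma PsiW_zero (L : ℕ) {A : Finset (ℕ × ℕ)} (w : Word A 0) : PsiW L w = id := by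
  simp [PsiW]

lemma PsiW_succ (L : ℕ) {A : Finset (ℕ × ℕ)} {n : ℕ} (w : Word A (n + 1)) :
    PsiW L w = Psi L (w 0).1 ∘ PsiW L (fun i : Fin n => w i.succ) := by
  simp [PsiW, List.ofFn_succ]

lemma foldr_comp_append (l₁ l₂ : List (ℝ × ℝ → ℝ × ℝ)) :
    (l₁ ++ l₂).foldr (· ∘ ·) id = l₁.foldr (· ∘ ·) id ∘ l₂.foldr (· ∘ ·) id := by
  induction l₁ with
  | nil => rfl
  | cons a l ih => simp only [List.cons_append, List.foldr_cons, ih]; rfl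

lemma PsiW_add (L : ℕ) {A : Finset (ℕ × ℕ)} {n k : ℕ} (w : Word A (n + k)) :
    PsiW L w = PsiW L (fun i : Fin n => w (Fin.castAdd k i)) ∘
      PsiW L (fun i : Fin k => w (Fin.natAdd n i)) := by
  unfold PsiW
  rw [List.ofFn_add, foldr_comp_append]
  rfl

/-- Integer position of the cell of a word. -/
def pos (L : ℕ) {A : Finset (ℕ × ℕ)} : {n : ℕ} → Word A n → ℕ × ℕ
  | 0, _ => (0, 0)
  | n + 1, w => ((pos L (fun i : Fin n => w i.succ)).1 + (w 0).1.1 * L ^ n,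
      (pos L (fun i : Fin n => w i.succ)).2 + (w 0).1.2 * L ^ n)

lemma PsiW_eq {L : ℕ} (hL : 0 < L) {A : Finset (ℕ × ℕ)} {n : ℕ} (w : Word A n) (x : ℝ × ℝ) :
    PsiW L w x = ((x.1 + (pos L w).1) / (L : ℝ) ^ n, (x.2 + (pos L w).2) / (L : ℝ) ^ n) := by
  have hL' : (L : ℝ) ≠ 0 := by positivity
  induction n with
  | zero => simp [PsiW_zero, pos]
  | succ n ih =>
    rw [PsiW_succ, Function.comp_apply, ih]
    simp only [Psi, pos]
    push_cast
    ext <;> simp only <;> field_simp <;> ring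

lemma pos_lt {L : ℕ} {A : Finset (ℕ × ℕ)} (hA : ∀ p ∈ A, p.1 < L ∧ p.2 < L) {n : ℕ}
    (w : Word A n) : (pos L w).1 < L ^ n ∧ (pos L w).2 < L ^ n := by
  induction n with
  | zero => simp [pos]
  | succ n ih =>
    have h1 := ih (fun i => w i.succ)
    have h2 := hA _ (w 0).2
    simp only [pos]
    constructor
    · have : ((w 0).1.1 + 1) * L ^ n ≤ L * L ^ n := Nat.mul_le_mul_right _ h2.1
      rw [pow_succ']; linarith [h1.1]
    · have : ((w 0).1.2 + 1) * L ^ n ≤ L * L ^ n := Nat.mul_le_mul_right _ h2.2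
      rw [pow_succ']; linarith [h1.2]

lemma digit_inj {a b c d N : ℕ} (ha : a < N) (hc : c < N) (h : a + b * N = c + d * N) :
    a = c ∧ b = d := by
  have hN : 0 < N := by omega
  have h1 := congrArg (· % N) h
  have h2 := congrArg (· / N) h
  simp only [Nat.add_mul_mod_self_right, Nat.mod_eq_of_lt ha, Nat.mod_eq_of_lt hc] at h1
  simp only [Nat.add_mul_div_right _ _ hN, Nat.div_eq_of_lt ha, Nat.div_eq_of_lt hc] at h2
  exact ⟨h1, by omega⟩

lemma pos_inj {L : ℕ} {A : Finset (ℕ × ℕ)} (hA : ∀ p ∈ A, p.1 < L ∧ p.2 < L) {n : ℕ}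
    (w w' : Word A n) (hw : pos L w = pos L w') : w = w' := by
  induction n with
  | zero => exact Subsingleton.elim _ _
  | succ n ih =>
    simp only [pos, Prod.mk.injEq] at hw
    have h1 := pos_lt hA (fun i => w i.succ)
    have h2 := pos_lt hA (fun i => w' i.succ)
    have h3 := digit_inj h1.1 h2.1 hw.1
    have h4 := digit_inj h1.2 h2.2 hw.2
    have h5 := ih _ _ (Prod.ext h3.1 h4.1)
    funext i
    refine Fin.cases ?_ (fun j => congrFun h5 j) i
    exact Subtype.ext (Prod.ext h3.2 h4.2)

lemma PsiW_inj {L : ℕ} (hL : 0 < L) {A : Finset (ℕ × ℕ)}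
    (hA : ∀ p ∈ A, p.1 < L ∧ p.2 < L) {n : ℕ}
    (w w' : Word A n) (x : ℝ × ℝ) (hw : PsiW L w x = PsiW L w' x) : w = w' := by
  have hL' : (L : ℝ) ^ n ≠ 0 := by positivity
  rw [PsiW_eq hL, PsiW_eq hL, Prod.mk.injEq, div_left_inj' hL', div_left_inj' hL'] at hw
  apply pos_inj hA
  ext
  · exact_mod_cast add_left_cancel hw.1
  · exact_mod_cast add_left_cancel hw.2

/-- Ordered edges of the unit square. -/
noncomputable def E0 : Finset ((ℝ × ℝ) × (ℝ × ℝ)) :=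
  (V0 ×ˢ V0).filter fun e => eudist e.1 e.2 = 1

/-- Ordered edges at level `n`. -/
noncomputable def EN (L : ℕ) (A : Finset (ℕ × ℕ)) (n : ℕ) : Finset ((ℝ × ℝ) × (ℝ × ℝ)) :=
  ((Finset.univ : Finset (Word A n)) ×ˢ E0).image fun z =>
    (PsiW L z.1 z.2.1, PsiW L z.1 z.2.2)

lemma mem_V0 {p : ℝ × ℝ} : p ∈ V0 ↔ (p.1 = 0 ∨ p.1 = 1) ∧ (p.2 = 0 ∨ p.2 = 1) := by
  obtain ⟨a, b⟩ := p
  simp only [V0, Finset.mem_insert, Finset.mem_singleton, Prod.mk.injEq]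
  tauto

lemma mem_E0 {e : (ℝ × ℝ) × (ℝ × ℝ)} :
    e ∈ E0 ↔ e.1 ∈ V0 ∧ e.2 ∈ V0 ∧ (e.1.1 - e.2.1) ^ 2 + (e.1.2 - e.2.2) ^ 2 = 1 := by
  simp [E0, eudist, and_assoc]

lemma mem_VN {L : ℕ} {A : Finset (ℕ × ℕ)} {n : ℕ} {x : ℝ × ℝ} :
    x ∈ VN L A n ↔ ∃ w : Word A n, ∃ p ∈ V0, PsiW L w p = x := by
  simp [VN]

lemma mem_EN {L : ℕ} {A : Finset (ℕ × ℕ)} {n : ℕ} {e : (ℝ × ℝ) × (ℝ × ℝ)} :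
    e ∈ EN L A n ↔ ∃ w : Word A n, ∃ d ∈ E0, e = (PsiW L w d.1, PsiW L w d.2) := by
  simp only [EN, Finset.mem_image, Finset.mem_product, Finset.mem_univ, true_and]
  constructor
  · rintro ⟨z, hd, rfl⟩
    exact ⟨z.1, z.2, hd, rfl⟩
  · rintro ⟨w, d, hd, rfl⟩
    exact ⟨(w, d), hd, rfl⟩

lemma EN_VN {L : ℕ} {A : Finset (ℕ × ℕ)} {n : ℕ} {e : (ℝ × ℝ) × (ℝ × ℝ)}
    (he : e ∈ EN L A n) : e.1 ∈ VN L A n ∧ e.2 ∈ VN L A n := by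
  obtain ⟨w, d, hd, rfl⟩ := mem_EN.1 he
  have := mem_E0.1 hd
  exact ⟨mem_VN.2 ⟨w, _, this.1, rfl⟩, mem_VN.2 ⟨w, _, this.2.1, rfl⟩⟩

lemma Dform_eq (L : ℕ) (A : Finset (ℕ × ℕ)) (n : ℕ) (f : ℝ × ℝ → ℝ) :
    Dform L A n f = (1 / 2) * ∑ e ∈ EN L A n, (f e.1 - f e.2) ^ 2 := by
  unfold Dform
  rw [← Finset.sum_product', ← Finset.sum_filter]
  congr 2
  ext e
  simp only [Finset.mem_filter, Finset.mem_product]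
  constructor
  · rintro ⟨-, w, p, hp, q, hq, hd, h1, h2⟩
    refine mem_EN.2 ⟨w, (p, q), ?_, Prod.ext h1 h2⟩
    simp [E0, hp, hq, hd]
  · intro he
    refine ⟨EN_VN he, ?_⟩
    obtain ⟨w, d, hd, rfl⟩ := mem_EN.1 he
    simp only [E0, Finset.mem_filter, Finset.mem_product] at hd
    exact ⟨w, d.1, hd.1.1, d.2, hd.1.2, hd.2, rfl, rfl⟩

lemma Dform_nonneg (L : ℕ) (A : Finset (ℕ × ℕ)) (n : ℕ) (f : ℝ × ℝ → ℝ) :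
    0 ≤ Dform L A n f := by
  rw [Dform_eq]
  have : 0 ≤ ∑ e ∈ EN L A n, (f e.1 - f e.2) ^ 2 := Finset.sum_nonneg fun _ _ => sq_nonneg _
  linarith

lemma Dform_congr {L : ℕ} {A : Finset (ℕ × ℕ)} {n : ℕ} {f g : ℝ × ℝ → ℝ}
    (hfg : ∀ x ∈ VN L A n, f x = g x) : Dform L A n f = Dform L A n g := by
  rw [Dform_eq, Dform_eq]
  congr 1
  refine Finset.sum_congr rfl fun e he => ?_
  rw [hfg _ (EN_VN he).1, hfg _ (EN_VN he).2]

lemma VN_unit {L : ℕ} (hL : 0 < L) {A : Finset (ℕ × ℕ)}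
    (hA : ∀ p ∈ A, p.1 < L ∧ p.2 < L) {n : ℕ} {x : ℝ × ℝ} (hx : x ∈ VN L A n) :
    (0 ≤ x.1 ∧ x.1 ≤ 1) ∧ (0 ≤ x.2 ∧ x.2 ≤ 1) := by
  obtain ⟨w, p, hp, rfl⟩ := mem_VN.1 hx
  have hN : (0 : ℝ) < (L : ℝ) ^ n := by positivity
  have h1 := pos_lt hA w
  have h2 : ((pos L w).1 : ℝ) + 1 ≤ (L : ℝ) ^ n := by exact_mod_cast h1.1
  have h3 : ((pos L w).2 : ℝ) + 1 ≤ (L : ℝ) ^ n := by exact_mod_cast h1.2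
  have hp' := mem_V0.1 hp
  have a1 : 0 ≤ p.1 ∧ p.1 ≤ 1 := by rcases hp'.1 with h | h <;> rw [h] <;> norm_num
  have a2 : 0 ≤ p.2 ∧ p.2 ≤ 1 := by rcases hp'.2 with h | h <;> rw [h] <;> norm_num
  rw [PsiW_eq hL]
  have b1 : (0 : ℝ) ≤ ((pos L w).1 : ℝ) := Nat.cast_nonneg _
  have b2 : (0 : ℝ) ≤ ((pos L w).2 : ℝ) := Nat.cast_nonneg _
  refine ⟨⟨by apply div_nonneg <;> linarith, ?_⟩, ⟨by apply div_nonneg <;> linarith, ?_⟩⟩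
  · rw [div_le_one hN]; linarith
  · rw [div_le_one hN]; linarith

lemma V0_VN {L : ℕ} {A : Finset (ℕ × ℕ)} (h : GoodCarpet L A) (n : ℕ) {p : ℝ × ℝ}
    (hp : p ∈ V0) : p ∈ VN L A n := by
  have hL := h.three_le
  have hL' : (L : ℝ) ≠ 0 := by positivity
  have key : ∃ a ∈ A, Psi L a p = p := by
    have h1 := mem_V0.1 hp
    have e1 : ∃ a : ℕ, (a = 0 ∨ a = L - 1) ∧ (p.1 + a) / (L : ℝ) = p.1 := by
      rcases h1.1 with e | e
      · exact ⟨0, Or.inl rfl, by simp [e]⟩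
      · refine ⟨L - 1, Or.inr rfl, ?_⟩
        rw [e, Nat.cast_sub (by omega)]; field_simp; simp
    have e2 : ∃ a : ℕ, (a = 0 ∨ a = L - 1) ∧ (p.2 + a) / (L : ℝ) = p.2 := by
      rcases h1.2 with e | e
      · exact ⟨0, Or.inl rfl, by simp [e]⟩
      · refine ⟨L - 1, Or.inr rfl, ?_⟩
        rw [e, Nat.cast_sub (by omega)]; field_simp; simp
    obtain ⟨a, ha, ea⟩ := e1
    obtain ⟨b, hb, eb⟩ := e2
    refine ⟨(a, b), h.flat_border a b (by omega) (by omega) (by tauto), ?_⟩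
    exact Prod.ext ea eb
  obtain ⟨a, ha, hpa⟩ := key
  refine mem_VN.2 ⟨fun _ => ⟨a, ha⟩, p, hp, ?_⟩
  induction n with
  | zero => rw [PsiW_zero]; rfl
  | succ n ih => rw [PsiW_succ, Function.comp_apply, ih, hpa]

/-- Invariance of the edges under a symmetry. -/
lemma EN_symm {L : ℕ} {A : Finset (ℕ × ℕ)} (σ : ℝ × ℝ → ℝ × ℝ)
    (h0 : ∀ e ∈ E0, (σ e.1, σ e.2) ∈ E0)
    (hσ : ∀ a ∈ A, ∃ b ∈ A, ∀ x, σ (Psi L a x) = Psi L b (σ x)) {n : ℕ}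
    {e : (ℝ × ℝ) × (ℝ × ℝ)} (he : e ∈ EN L A n) : (σ e.1, σ e.2) ∈ EN L A n := by
  obtain ⟨w, d, hd, rfl⟩ := mem_EN.1 he
  have key : ∀ (n : ℕ) (w : Word A n), ∃ w' : Word A n, ∀ x, σ (PsiW L w x) = PsiW L w' (σ x) := by
    intro n
    induction n with
    | zero => intro w; exact ⟨w, fun x => by simp [PsiW_zero]⟩
    | succ n ih =>
      intro w
      obtain ⟨w', hw'⟩ := ih (fun i => w i.succ)
      obtain ⟨b, hb, hb'⟩ := hσ _ (w 0).2
      refine ⟨Fin.cons ⟨b, hb⟩ w', fun x => ?_⟩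
      rw [PsiW_succ, PsiW_succ]
      simp [hb', hw']
  obtain ⟨w', hw'⟩ := key n w
  exact mem_EN.2 ⟨w', (σ d.1, σ d.2), h0 _ hd, by simp [hw']⟩

lemma Dform_symm {L : ℕ} {A : Finset (ℕ × ℕ)} (σ : ℝ × ℝ → ℝ × ℝ) (hi : Function.Injective σ)
    (h0 : ∀ e ∈ E0, (σ e.1, σ e.2) ∈ E0)
    (hσ : ∀ a ∈ A, ∃ b ∈ A, ∀ x, σ (Psi L a x) = Psi L b (σ x)) (n : ℕ) (f : ℝ × ℝ → ℝ) :
    Dform L A n (fun x => f (σ x)) ≤ Dform L A n f := by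
  rw [Dform_eq, Dform_eq]
  refine mul_le_mul_of_nonneg_left ?_ (by norm_num)
  have hinj : Function.Injective (fun e : (ℝ × ℝ) × (ℝ × ℝ) => (σ e.1, σ e.2)) := by
    intro a b hab
    simp only [Prod.mk.injEq] at hab
    exact Prod.ext (hi hab.1) (hi hab.2)
  have := Finset.sum_image (s := EN L A n) (g := fun e : (ℝ × ℝ) × (ℝ × ℝ) => (σ e.1, σ e.2))
    (f := fun e => (f e.1 - f e.2) ^ 2) hinj.injOn
  rw [← this]
  refine Finset.sum_le_sum_of_subset_of_nonneg ?_ fun _ _ _ => sq_nonneg _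
  intro e he
  obtain ⟨d, hd, rfl⟩ := Finset.mem_image.1 he
  exact EN_symm σ h0 hσ hd

lemma Dform_swap {L : ℕ} {A : Finset (ℕ × ℕ)} (h : GoodCarpet L A) (n : ℕ) (f : ℝ × ℝ → ℝ) :
    Dform L A n (fun x => f (x.2, x.1)) ≤ Dform L A n f := by
  refine Dform_symm (fun x => (x.2, x.1)) ?_ ?_ ?_ n f
  · intro a b hab
    simp only [Prod.mk.injEq] at hab
    exact Prod.ext hab.2 hab.1
  · intro e he
    rw [mem_E0, mem_V0, mem_V0] at he ⊢
    simp only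
    refine ⟨he.1.symm, he.2.1.symm, by linarith [he.2.2]⟩
  · intro a ha
    exact ⟨(a.2, a.1), h.symm_swap _ _ ha, fun x => rfl⟩

lemma Dform_refl {L : ℕ} {A : Finset (ℕ × ℕ)} (h : GoodCarpet L A) (n : ℕ) (f : ℝ × ℝ → ℝ) :
    Dform L A n (fun x => f (x.1, 1 - x.2)) ≤ Dform L A n f := by
  have hL := h.three_le
  have hL' : (L : ℝ) ≠ 0 := by positivity
  refine Dform_symm (fun x => (x.1, 1 - x.2)) ?_ ?_ ?_ n f
  · intro a b hab
    simp only [Prod.mk.injEq] at hab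
    exact Prod.ext hab.1 (by linarith [hab.2])
  · intro e he
    rw [mem_E0, mem_V0, mem_V0] at he ⊢
    simp only
    obtain ⟨⟨h1, h2⟩, ⟨h3, h4⟩, h5⟩ := he
    refine ⟨⟨h1, ?_⟩, ⟨h3, ?_⟩, by linarith [h5]⟩
    · rcases h2 with h | h <;> simp [h]
    · rcases h4 with h | h <;> simp [h]
  · intro a ha
    refine ⟨(a.1, L - 1 - a.2), h.symm_swap _ _ (h.symm_reflect _ _ (h.symm_swap _ _ ha)), ?_⟩
    intro x
    have := (h.mem_lt _ ha).2
    have e : ((L - 1 - a.2 : ℕ) : ℝ) = (L : ℝ) - 1 - a.2 := by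
      rw [Nat.cast_sub (by omega), Nat.cast_sub (by omega)]; simp
    simp only [Psi, e]
    ext
    · rfl
    · simp only; field_simp; ring

lemma RRbar_nonneg (L : ℕ) (A : Finset (ℕ × ℕ)) (k : ℕ) : 0 ≤ RRbar L A k := by
  unfold RRbar EffRes
  refine inv_nonneg.2 (Real.sInf_nonneg ?_)
  rintro e ⟨f, -, -, rfl⟩
  exact Dform_nonneg _ _ _ _

lemma clamp_sq (a b : ℝ) : (max 0 (min 1 a) - max 0 (min 1 b)) ^ 2 ≤ (a - b) ^ 2 := by
  refine sq_le_sq.2 ?_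
  have h1 := abs_max_sub_max_le_max 0 (min 1 a) 0 (min 1 b)
  have h2 := abs_min_sub_min_le_max 1 a 1 b
  simp only [sub_self, abs_zero] at h1 h2
  rw [max_eq_right (abs_nonneg (min 1 a - min 1 b))] at h1
  rw [max_eq_right (abs_nonneg (a - b))] at h2
  exact h1.trans h2

/-- A good profile function. -/
lemma exists_profile {L : ℕ} {A : Finset (ℕ × ℕ)} (h : GoodCarpet L A) (k : ℕ) :
    ∃ g : ℝ × ℝ → ℝ, (∀ x, 0 ≤ g x ∧ g x ≤ 1) ∧ (∀ y, g (0, y) = 0) ∧ (∀ y, g (1, y) = 1) ∧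
      (∀ x, g (x, 1) = g (x, 0)) ∧ RRbar L A k * Dform L A k g ≤ 2 := by
  have hL : 0 < L := by have := h.three_le; omega
  set S := (VN L A k : Set (ℝ × ℝ)) ∩ ({(0 : ℝ)} ×ˢ Set.Icc (0 : ℝ) 1) with hS
  set T := (VN L A k : Set (ℝ × ℝ)) ∩ ({(1 : ℝ)} ×ˢ Set.Icc (0 : ℝ) 1) with hT
  -- near minimizer
  have h1 : ∃ φ : ℝ × ℝ → ℝ, (∀ x ∈ S, φ x = 1) ∧ (∀ x ∈ T, φ x = 0) ∧
      RRbar L A k * Dform L A k φ ≤ 2 := by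
    set Q := {e : ℝ | ∃ f : ℝ × ℝ → ℝ,
      (∀ x ∈ S, f x = 1) ∧ (∀ x ∈ T, f x = 0) ∧ e = Dform L A k f} with hQ
    have hR : RRbar L A k = (sInf Q)⁻¹ := rfl
    have hne : Q.Nonempty := by
      refine ⟨_, fun x => 1 - x.1, ?_, ?_, rfl⟩
      · rintro x ⟨-, hx, -⟩; simp only [Set.mem_singleton_iff] at hx; simp [hx]
      · rintro x ⟨-, hx, -⟩; simp only [Set.mem_singleton_iff] at hx; simp [hx]
    have hnn : 0 ≤ sInf Q := by
      refine Real.sInf_nonneg ?_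
      rintro e ⟨f, -, -, rfl⟩
      exact Dform_nonneg _ _ _ _
    rcases hnn.eq_or_lt with h0 | h0
    · obtain ⟨e, φ, ha, hb, -⟩ := hne
      refine ⟨φ, ha, hb, ?_⟩
      rw [hR, ← h0]; simp
    · obtain ⟨e, ⟨φ, ha, hb, rfl⟩, hlt⟩ := exists_lt_of_csInf_lt hne
        (show sInf Q < 2 * sInf Q by linarith)
      refine ⟨φ, ha, hb, ?_⟩
      rw [hR, inv_mul_le_iff₀ h0]; linarith
  obtain ⟨φ, hφ1, hφ0, hφ⟩ := h1
  -- clamp and normalise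
  let g1 : ℝ × ℝ → ℝ := fun x =>
    if x.1 = 0 then 0 else if x.1 = 1 then 1 else max 0 (min 1 (1 - φ x))
  have hg1 : ∀ x ∈ VN L A k, g1 x = max 0 (min 1 (1 - φ x)) := by
    intro x hx
    have hu := VN_unit hL h.mem_lt hx
    by_cases e0 : x.1 = 0
    · have : φ x = 1 := hφ1 x ⟨hx, e0, hu.2⟩
      simp [g1, e0, this]
    · by_cases e1 : x.1 = 1
      · have : φ x = 0 := hφ0 x ⟨hx, e1, hu.2⟩
        simp [g1, e1, this]
      · simp [g1, e0, e1]
  have hb1 : ∀ x, 0 ≤ g1 x ∧ g1 x ≤ 1 := by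
    intro x
    simp only [g1]
    split_ifs
    · norm_num
    · norm_num
    · exact ⟨le_max_left _ _, max_le (by norm_num) (min_le_left _ _)⟩
  have hD1 : Dform L A k g1 ≤ Dform L A k φ := by
    rw [Dform_congr hg1, Dform_eq, Dform_eq]
    refine mul_le_mul_of_nonneg_left (Finset.sum_le_sum fun e _ => ?_) (by norm_num)
    refine (clamp_sq _ _).trans (le_of_eq (by ring))
  let g : ℝ × ℝ → ℝ := fun x => (g1 x + g1 (x.1, 1 - x.2)) / 2
  have hD : Dform L A k g ≤ Dform L A k g1 := by
    have hr := Dform_refl h k g1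
    have : Dform L A k g ≤ (Dform L A k g1 + Dform L A k (fun x => g1 (x.1, 1 - x.2))) / 2 := by
      rw [Dform_eq, Dform_eq, Dform_eq]
      have : ∑ e ∈ EN L A k, (g e.1 - g e.2) ^ 2 ≤
          ∑ e ∈ EN L A k, ((g1 e.1 - g1 e.2) ^ 2 +
            (g1 (e.1.1, 1 - e.1.2) - g1 (e.2.1, 1 - e.2.2)) ^ 2) / 2 := by
        refine Finset.sum_le_sum fun e _ => ?_
        simp only [g]
        nlinarith [sq_nonneg ((g1 e.1 - g1 e.2) -
          (g1 (e.1.1, 1 - e.1.2) - g1 (e.2.1, 1 - e.2.2)))]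
      rw [← Finset.sum_div, Finset.sum_add_distrib] at this
      linarith
    linarith
  refine ⟨g, ?_, ?_, ?_, ?_, ?_⟩
  · intro x
    have a := hb1 x
    have b := hb1 (x.1, 1 - x.2)
    simp only [g]
    constructor <;> linarith
  · intro y; simp [g, g1]
  · intro y; simp [g, g1]
  · intro x; simp only [g]; norm_num; ring
  · exact (mul_le_mul_of_nonneg_left (hD.trans hD1) (RRbar_nonneg _ _ _)).trans hφ

/-- Bilinear interpolation. -/
def bil (a b c d X Y : ℝ) : ℝ :=
  a * (1 - X) * (1 - Y) + b * X * (1 - Y) + c * (1 - X) * Y + d * X * Y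

lemma bil_le {a b c d X Y M : ℝ} (hX : 0 ≤ X ∧ X ≤ 1) (hY : 0 ≤ Y ∧ Y ≤ 1)
    (ha : a ≤ M) (hb : b ≤ M) (hc : c ≤ M) (hd : d ≤ M) : bil a b c d X Y ≤ M := by
  have hX' : 0 ≤ 1 - X := by linarith
  have hY' : 0 ≤ 1 - Y := by linarith
  have e1 := mul_nonneg (sub_nonneg.2 ha) (mul_nonneg hX' hY')
  have e2 := mul_nonneg (sub_nonneg.2 hb) (mul_nonneg hX.1 hY')
  have e3 := mul_nonneg (sub_nonneg.2 hc) (mul_nonneg hX' hY.1)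
  have e4 := mul_nonneg (sub_nonneg.2 hd) (mul_nonneg hX.1 hY.1)
  unfold bil
  linarith

lemma le_bil {a b c d X Y M : ℝ} (hX : 0 ≤ X ∧ X ≤ 1) (hY : 0 ≤ Y ∧ Y ≤ 1)
    (ha : M ≤ a) (hb : M ≤ b) (hc : M ≤ c) (hd : M ≤ d) : M ≤ bil a b c d X Y := by
  have := bil_le (M := -M) hX hY (neg_le_neg ha) (neg_le_neg hb) (neg_le_neg hc) (neg_le_neg hd)
  have e : bil (-a) (-b) (-c) (-d) X Y = - bil a b c d X Y := by unfold bil; ring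
  linarith

lemma conv_sq {u v t T : ℝ} (ht : 0 ≤ t ∧ t ≤ 1) (hu : u ^ 2 ≤ T) (hv : v ^ 2 ≤ T) :
    (u * (1 - t) + v * t) ^ 2 ≤ T := by
  have h1 : 0 ≤ t * (1 - t) := mul_nonneg ht.1 (by linarith)
  have h2 := mul_nonneg h1 (sq_nonneg (u - v))
  have h3 := mul_nonneg ht.1 (sub_nonneg.2 hv)
  have h4 := mul_nonneg (show 0 ≤ 1 - t by linarith) (sub_nonneg.2 hu)
  linarith

lemma two_sq_aux {U V P Q T : ℝ} (hp : P ^ 2 ≤ T) (hq : Q ^ 2 ≤ T) :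
    (U * P + V * Q) ^ 2 ≤ 2 * T * (U ^ 2 + V ^ 2) := by
  have k1 := mul_le_mul_of_nonneg_left hp (sq_nonneg U)
  have k2 := mul_le_mul_of_nonneg_left hq (sq_nonneg V)
  have k3 := sq_nonneg (U * P - V * Q)
  linarith

lemma bil_sq {a b c d X Y X' Y' T : ℝ} (hX' : 0 ≤ X' ∧ X' ≤ 1) (hY : 0 ≤ Y ∧ Y ≤ 1)
    (h1 : (b - a) ^ 2 ≤ T) (h2 : (d - c) ^ 2 ≤ T) (h3 : (c - a) ^ 2 ≤ T) (h4 : (d - b) ^ 2 ≤ T) :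
    (bil a b c d X Y - bil a b c d X' Y') ^ 2 ≤ 2 * T * ((X - X') ^ 2 + (Y - Y') ^ 2) := by
  have e : bil a b c d X Y - bil a b c d X' Y' =
      (X - X') * ((b - a) * (1 - Y) + (d - c) * Y) +
      (Y - Y') * ((c - a) * (1 - X') + (d - b) * X') := by unfold bil; ring
  rw [e]
  have hp := conv_sq hY h1 h2
  have hq := conv_sq hX' h3 h4
  exact two_sq_aux hp hq

/-- The cell interpolation. -/
noncomputable def cellU (h : ℝ × ℝ → ℝ) (g : ℤ → ℤ → ℝ) (i j : ℤ) (s t : ℝ) : ℝ :=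
  bil (g i j) (g (i + 1) j) (g i (j + 1)) (g (i + 1) (j + 1))
    (h (s - i, t - j)) (h (t - j, s - i))

lemma cellU_floor {h : ℝ × ℝ → ℝ} (h0 : ∀ y, h (0, y) = 0) (h1 : ∀ y, h (1, y) = 1)
    (hs : ∀ x, h (x, 1) = h (x, 0)) (g : ℤ → ℤ → ℝ) (i j : ℤ) (s t : ℝ)
    (hi : i ≤ s ∧ s ≤ i + 1) (hj : j ≤ t ∧ t ≤ j + 1) :
    cellU h g ⌊s⌋ ⌊t⌋ s t = cellU h g i j s t := by
  have st1 : ∀ j', cellU h g ⌊s⌋ j' s t = cellU h g i j' s t := by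
    intro j'
    rcases hi.2.lt_or_eq with hlt | heq
    · rw [Int.floor_eq_iff.2 ⟨hi.1, hlt⟩]
    · have : ⌊s⌋ = i + 1 := by
        rw [Int.floor_eq_iff]; push_cast; constructor <;> linarith
      rw [this, heq]
      simp [cellU, bil, h0, h1, hs]
  rw [st1]
  rcases hj.2.lt_or_eq with hlt | heq
  · rw [Int.floor_eq_iff.2 ⟨hj.1, hlt⟩]
  · have : ⌊t⌋ = j + 1 := by
      rw [Int.floor_eq_iff]; push_cast; constructor <;> linarith
    rw [this, heq]
    simp [cellU, bil, h0, h1, hs]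

/-- The extension operator built from a profile `h`. -/
noncomputable def extOp (L : ℕ) (A : Finset (ℕ × ℕ)) (n : ℕ) (h : ℝ × ℝ → ℝ)
    (f : ℝ × ℝ → ℝ) (x : ℝ × ℝ) : ℝ :=
  cellU h (fun i j => if (((i : ℝ) / (L : ℝ) ^ n, (j : ℝ) / (L : ℝ) ^ n) : ℝ × ℝ) ∈ VN L A n
      then f ((i : ℝ) / (L : ℝ) ^ n, (j : ℝ) / (L : ℝ) ^ n) else 0)
    ⌊(L : ℝ) ^ n * x.1⌋ ⌊(L : ℝ) ^ n * x.2⌋ ((L : ℝ) ^ n * x.1) ((L : ℝ) ^ n * x.2)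

lemma extOp_PsiW {L : ℕ} (hL : 0 < L) {A : Finset (ℕ × ℕ)} {n : ℕ} {h : ℝ × ℝ → ℝ}
    (h0 : ∀ y, h (0, y) = 0) (h1 : ∀ y, h (1, y) = 1)
    (hs : ∀ x, h (x, 1) = h (x, 0)) (f : ℝ × ℝ → ℝ) (w : Word A n) (v : ℝ × ℝ)
    (hv : (0 ≤ v.1 ∧ v.1 ≤ 1) ∧ (0 ≤ v.2 ∧ v.2 ≤ 1)) :
    extOp L A n h f (PsiW L w v) =
      bil (f (PsiW L w (0, 0))) (f (PsiW L w (1, 0))) (f (PsiW L w (0, 1))) (f (PsiW L w (1, 1)))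
        (h v) (h (v.2, v.1)) := by
  have hN : (L : ℝ) ^ n ≠ 0 := by positivity
  have e1 : (L : ℝ) ^ n * (PsiW L w v).1 = v.1 + (pos L w).1 := by
    rw [PsiW_eq hL]; field_simp
  have e2 : (L : ℝ) ^ n * (PsiW L w v).2 = v.2 + (pos L w).2 := by
    rw [PsiW_eq hL]; field_simp
  unfold extOp
  rw [e1, e2, cellU_floor h0 h1 hs _ ((pos L w).1 : ℤ) ((pos L w).2 : ℤ)]
  · have key : ∀ p ∈ V0, ∀ i j : ℤ, (i : ℝ) = p.1 + (pos L w).1 → (j : ℝ) = p.2 + (pos L w).2 →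
        (if (((i : ℝ) / (L : ℝ) ^ n, (j : ℝ) / (L : ℝ) ^ n) : ℝ × ℝ) ∈ VN L A n
          then f ((i : ℝ) / (L : ℝ) ^ n, (j : ℝ) / (L : ℝ) ^ n) else 0) = f (PsiW L w p) := by
      intro p hp i j hi hj
      rw [hi, hj, ← PsiW_eq hL, if_pos (mem_VN.2 ⟨w, p, hp, rfl⟩)]
    unfold cellU
    beta_reduce
    rw [key (0, 0) (mem_V0.2 (by simp)) _ _ (by simp) (by simp),
      key (1, 0) (mem_V0.2 (by simp)) _ _ (by simp [add_comm]) (by simp),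
      key (0, 1) (mem_V0.2 (by simp)) _ _ (by simp) (by simp [add_comm]),
      key (1, 1) (mem_V0.2 (by simp)) _ _ (by simp [add_comm]) (by simp [add_comm])]
    simp
  · push_cast; constructor <;> linarith [hv.1.1, hv.1.2]
  · push_cast; constructor <;> linarith [hv.2.1, hv.2.2]

lemma sum_image_le' {α β : Type*} [DecidableEq β] (s : Finset α) (g : α → β) (F : β → ℝ)
    (hF : ∀ b, 0 ≤ F b) : ∑ b ∈ s.image g, F b ≤ ∑ a ∈ s, F (g a) := by
  rw [← Finset.sum_fiberwise_of_maps_to (s := s) (t := s.image g) (g := g)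
    (fun a ha => Finset.mem_image_of_mem g ha)]
  refine Finset.sum_le_sum fun b hb => ?_
  obtain ⟨a, ha, rfl⟩ := Finset.mem_image.1 hb
  exact Finset.single_le_sum (f := fun a => F (g a)) (fun _ _ => hF _)
    (Finset.mem_filter.2 ⟨ha, rfl⟩)

lemma Dform_add_le (L : ℕ) (A : Finset (ℕ × ℕ)) (n k : ℕ) (u : ℝ × ℝ → ℝ) :
    Dform L A (n + k) u ≤ ∑ w : Word A n, Dform L A k (fun v => u (PsiW L w v)) := by
  simp only [Dform_eq]
  rw [← Finset.mul_sum]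
  refine mul_le_mul_of_nonneg_left ?_ (by norm_num)
  let G : Word A n × ((ℝ × ℝ) × (ℝ × ℝ)) → (ℝ × ℝ) × (ℝ × ℝ) :=
    fun z => (PsiW L z.1 z.2.1, PsiW L z.1 z.2.2)
  have hsub : EN L A (n + k) ⊆ ((Finset.univ : Finset (Word A n)) ×ˢ EN L A k).image G := by
    intro e he
    obtain ⟨w, d, hd, rfl⟩ := mem_EN.1 he
    refine Finset.mem_image.2 ⟨(fun i => w (Fin.castAdd k i),
      (PsiW L (fun i => w (Fin.natAdd n i)) d.1, PsiW L (fun i => w (Fin.natAdd n i)) d.2)),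
      ?_, ?_⟩
    · simp only [Finset.mem_product, Finset.mem_univ, true_and]
      exact mem_EN.2 ⟨_, d, hd, rfl⟩
    · simp only [G]
      rw [PsiW_add L w]; rfl
  refine (Finset.sum_le_sum_of_subset_of_nonneg hsub fun _ _ _ => sq_nonneg _).trans ?_
  refine (sum_image_le' _ G (fun e => (u e.1 - u e.2) ^ 2) fun _ => sq_nonneg _).trans ?_
  rw [Finset.sum_product]

lemma E0_card : (E0.card : ℝ) ≤ 16 := by
  have h1 : E0.card ≤ (V0 ×ˢ V0).card := Finset.card_filter_le _ _
  have h2 : V0.card ≤ 4 := Finset.card_le_four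
  rw [Finset.card_product] at h1
  have : V0.card * V0.card ≤ 4 * 4 := Nat.mul_le_mul h2 h2
  exact_mod_cast h1.trans this

lemma sum_cells_le {L : ℕ} (hL : 0 < L) {A : Finset (ℕ × ℕ)}
    (hA : ∀ p ∈ A, p.1 < L ∧ p.2 < L) (n : ℕ) (f : ℝ × ℝ → ℝ) :
    ∑ w : Word A n, ∑ e ∈ E0, (f (PsiW L w e.1) - f (PsiW L w e.2)) ^ 2 ≤
      32 * Dform L A n f := by
  rw [Finset.sum_comm]
  have hb : ∀ e ∈ E0, ∑ w : Word A n, (f (PsiW L w e.1) - f (PsiW L w e.2)) ^ 2 ≤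
      2 * Dform L A n f := by
    intro e he
    let G : Word A n → (ℝ × ℝ) × (ℝ × ℝ) := fun w => (PsiW L w e.1, PsiW L w e.2)
    have hG : Function.Injective G := by
      intro w w' hw
      exact PsiW_inj hL hA w w' e.1 (congrArg Prod.fst hw)
    have := Finset.sum_image (s := (Finset.univ : Finset (Word A n))) (g := G)
      (f := fun d => (f d.1 - f d.2) ^ 2) hG.injOn
    simp only [G] at this
    rw [← this, Dform_eq, ← mul_assoc]
    norm_num
    refine Finset.sum_le_sum_of_subset_of_nonneg ?_ fun _ _ _ => sq_nonneg _
    intro d hd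
    obtain ⟨w, -, rfl⟩ := Finset.mem_image.1 hd
    exact mem_EN.2 ⟨w, e, he, rfl⟩
  refine (Finset.sum_le_sum hb).trans ?_
  rw [Finset.sum_const, nsmul_eq_mul]
  have := mul_le_mul_of_nonneg_right E0_card
    (show 0 ≤ 2 * Dform L A n f by have := Dform_nonneg L A n f; linarith)
  linarith

lemma cell_energy {L : ℕ} {A : Finset (ℕ × ℕ)} (hc : GoodCarpet L A) {n k : ℕ} {h : ℝ × ℝ → ℝ}
    (hb : ∀ x, 0 ≤ h x ∧ h x ≤ 1) (h0 : ∀ y, h (0, y) = 0) (h1 : ∀ y, h (1, y) = 1)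
    (hs : ∀ x, h (x, 1) = h (x, 0)) (f : ℝ × ℝ → ℝ) (w : Word A n) :
    Dform L A k (fun v => extOp L A n h f (PsiW L w v)) ≤
      4 * Dform L A k h * ∑ e ∈ E0, (f (PsiW L w e.1) - f (PsiW L w e.2)) ^ 2 := by
  have hL : 0 < L := by have := hc.three_le; omega
  set T := ∑ e ∈ E0, (f (PsiW L w e.1) - f (PsiW L w e.2)) ^ 2 with hT
  have hTe : ∀ p q : ℝ × ℝ, (p, q) ∈ E0 → (f (PsiW L w p) - f (PsiW L w q)) ^ 2 ≤ T := by
    intro p q hpq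
    exact Finset.single_le_sum (f := fun e : (ℝ × ℝ) × (ℝ × ℝ) =>
      (f (PsiW L w e.1) - f (PsiW L w e.2)) ^ 2) (fun _ _ => sq_nonneg _) hpq
  have hT0 : 0 ≤ T := Finset.sum_nonneg fun _ _ => sq_nonneg _
  have hsw := Dform_swap hc k h
  have main : Dform L A k (fun v => extOp L A n h f (PsiW L w v)) ≤
      2 * T * (Dform L A k h + Dform L A k (fun x => h (x.2, x.1))) := by
    rw [Dform_congr (fun v hv => extOp_PsiW hL h0 h1 hs f w v (VN_unit hL hc.mem_lt hv))]
    rw [Dform_eq, Dform_eq, Dform_eq, ← mul_add, ← Finset.sum_add_distrib, mul_left_comm]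
    refine mul_le_mul_of_nonneg_left ?_ (by norm_num)
    rw [Finset.mul_sum]
    refine (Finset.sum_le_sum fun e _ => ?_)
    refine bil_sq (hb _) (hb _) (hTe _ _ ?_) (hTe _ _ ?_) (hTe _ _ ?_) (hTe _ _ ?_) <;>
      simp [mem_E0, mem_V0]
  have := mul_le_mul_of_nonneg_left hsw (show (0 : ℝ) ≤ 2 * T from mul_nonneg (by norm_num) hT0)
  linarith

/-- Local minimum and maximum principle, abstractly. -/
lemma inf_sup_eq {α : Type*} {P Q : Finset α} (hP : P.Nonempty) (hPQ : P ⊆ Q) (f g : α → ℝ)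
    (hfg : ∀ p ∈ P, g p = f p)
    (hle : ∀ M, (∀ p ∈ P, f p ≤ M) → ∀ q ∈ Q, g q ≤ M)
    (hge : ∀ M, (∀ p ∈ P, M ≤ f p) → ∀ q ∈ Q, M ≤ g q) :
    sInf (f '' (P : Set α)) = sInf (g '' (Q : Set α)) ∧
      sSup (f '' (P : Set α)) = sSup (g '' (Q : Set α)) := by
  have hPn : (f '' (P : Set α)).Nonempty := by simpa using hP
  have hQn : (g '' (Q : Set α)).Nonempty := by simpa using hP.mono hPQ
  have fP : (f '' (P : Set α)).Finite := P.finite_toSet.image _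
  have fQ : (g '' (Q : Set α)).Finite := Q.finite_toSet.image _
  have hsub : f '' (P : Set α) ⊆ g '' (Q : Set α) := by
    rintro _ ⟨p, hp, rfl⟩
    exact ⟨p, hPQ hp, hfg p hp⟩
  constructor
  · apply le_antisymm
    · refine le_csInf hQn ?_
      rintro _ ⟨q, hq, rfl⟩
      exact hge _ (fun p hp => csInf_le fP.bddBelow ⟨p, hp, rfl⟩) q hq
    · exact csInf_le_csInf fQ.bddBelow hPn hsub
  · apply le_antisymm
    · exact csSup_le_csSup fQ.bddAbove hPn hsub
    · refine csSup_le hQn ?_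
      rintro _ ⟨q, hq, rfl⟩
      exact hle _ (fun p hp => le_csSup fP.bddAbove ⟨p, hp, rfl⟩) q hq

/-- Proposition 3.4 (2), planar case: existence of the extension
operator `𝔈_{n,m}` with local min/max preservation and energy bound. -/
theorem extension_estimate (L : ℕ) (A : Finset (ℕ × ℕ)) (h : GoodCarpet L A) :
    ∃ c : ℝ, 1 ≤ c ∧ ∀ n m : ℕ, n ≤ m →
      ∃ Ext : (ℝ × ℝ → ℝ) → (ℝ × ℝ → ℝ),
        -- `Ext` only depends on the restriction to `V_n`, i.e. it is a genuine map
        -- from functions on `V_n` to functions on `V_m`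
        (∀ f g : ℝ × ℝ → ℝ, (∀ x ∈ VN L A n, f x = g x) → Ext f = Ext g) ∧
        ∀ f : ℝ × ℝ → ℝ,
          -- (a) `Ext f` restricts to `f` on `V_n`
          (∀ x ∈ VN L A n, Ext f x = f x) ∧
          -- (b) cellwise preservation of min and max
          (∀ w : Word A n,
            sInf ((fun p => f (PsiW L w p)) '' (V0 : Set (ℝ × ℝ))) =
              sInf ((fun v => Ext f (PsiW L w v)) '' (VN L A (m - n) : Set (ℝ × ℝ))) ∧
            sSup ((fun p => f (PsiW L w p)) '' (V0 : Set (ℝ × ℝ))) =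
              sSup ((fun v => Ext f (PsiW L w v)) '' (VN L A (m - n) : Set (ℝ × ℝ)))) ∧
          -- (c) energy estimate
          RRbar L A (m - n) * Dform L A m (Ext f) ≤ c * Dform L A n f := by
  have hL : 0 < L := by have := h.three_le; omega
  refine ⟨256, by norm_num, fun n m hnm => ?_⟩
  obtain ⟨k, rfl⟩ := Nat.exists_eq_add_of_le hnm
  rw [Nat.add_sub_cancel_left]
  obtain ⟨g, gb, g0, g1, gs, gR⟩ := exists_profile h k
  have hcorner : ∀ (f : ℝ × ℝ → ℝ) (w : Word A n), ∀ p ∈ V0,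
      extOp L A n g f (PsiW L w p) = f (PsiW L w p) := by
    intro f w p hp
    rw [extOp_PsiW hL g0 g1 gs f w p (VN_unit hL h.mem_lt (V0_VN h 0 hp))]
    obtain ⟨a, b⟩ := p
    obtain ⟨h1, h2⟩ := mem_V0.1 hp
    simp only at h1 h2
    rcases h1 with rfl | rfl <;> rcases h2 with rfl | rfl <;> simp [bil, g0, g1]
  refine ⟨extOp L A n g, ?_, fun f => ⟨?_, ?_, ?_⟩⟩
  · intro f f' hff
    have : ∀ x : ℝ × ℝ, (if x ∈ VN L A n then f x else 0) = if x ∈ VN L A n then f' x else 0 := by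
      intro x
      split_ifs with hx
      · exact hff x hx
      · rfl
    funext x
    simp only [extOp, this]
  · intro x hx
    obtain ⟨w, p, hp, rfl⟩ := mem_VN.1 hx
    exact hcorner f w p hp
  · intro w
    refine inf_sup_eq ⟨((0 : ℝ), (0 : ℝ)), mem_V0.2 (by simp)⟩ (fun p hp => V0_VN h k hp) _ _
      (fun p hp => hcorner f w p hp) ?_ ?_
    · intro M hM q hq
      rw [extOp_PsiW hL g0 g1 gs f w q (VN_unit hL h.mem_lt hq)]
      exact bil_le (gb _) (gb _) (hM _ (mem_V0.2 (by simp))) (hM _ (mem_V0.2 (by simp)))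
        (hM _ (mem_V0.2 (by simp))) (hM _ (mem_V0.2 (by simp)))
    · intro M hM q hq
      rw [extOp_PsiW hL g0 g1 gs f w q (VN_unit hL h.mem_lt hq)]
      exact le_bil (gb _) (gb _) (hM _ (mem_V0.2 (by simp))) (hM _ (mem_V0.2 (by simp)))
        (hM _ (mem_V0.2 (by simp))) (hM _ (mem_V0.2 (by simp)))
  · have hD : Dform L A (n + k) (extOp L A n g f) ≤
        4 * Dform L A k g * (32 * Dform L A n f) := by
      refine (Dform_add_le L A n k _).trans ?_
      refine (Finset.sum_le_sum fun w _ => cell_energy h gb g0 g1 gs f w).trans ?_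
      rw [← Finset.mul_sum]
      refine mul_le_mul_of_nonneg_left (sum_cells_le hL h.mem_lt n f) ?_
      have := Dform_nonneg L A k g
      linarith
    have h1 := mul_le_mul_of_nonneg_left hD (RRbar_nonneg L A k)
    have h2 := mul_le_mul_of_nonneg_right gR (Dform_nonneg L A n f)
    linarith



end Carpet
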